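/- Suppose A is a real symmetric n×n matrix (n ≥ 2) whose leading principal minors D_1, …, D_n satisfy D_1 = 0 and sign(D_k) = (-1)^{k-1} for all k ≥ 2. Then A has inertia (1, n−1, 0). -/

import Mathlib

/-- The leading principal minor of order k+1 (the determinant of the top-left
(k+1)×(k+1) submatrix). -/
noncomputable def leadMinor {n : ℕ} (A : Matrix (Fin n) (Fin n) ℝ) (k : Fin n) : ℝ :=
  (A.submatrix (Fin.castLE k.2) (Fin.castLE k.2)).det

open Matrix in
theorem Matrix.IsHermitian.dotProduct_mulVec_eq_sum_eigenvalues {ι : Type*} [Fintype ι]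
    [DecidableEq ι] {A : Matrix ι ι ℝ} (hA : A.IsHermitian) (x : ι → ℝ) :
    x ⬝ᵥ A *ᵥ x = ∑ i, hA.eigenvalues i *
      ((hA.eigenvectorUnitary : Matrix ι ι ℝ)ᵀ *ᵥ x) i ^ 2 := by
  have h : A = (hA.eigenvectorUnitary : Matrix ι ι ℝ) * diagonal hA.eigenvalues *
      (hA.eigenvectorUnitary : Matrix ι ι ℝ)ᵀ := by
    conv_lhs => rw [hA.spectral_theorem, Unitary.conjStarAlgAut_apply]
    rfl
  conv_lhs => rw [h]
  rw [← mulVec_mulVec, ← mulVec_mulVec, dotProduct_mulVec, ← mulVec_transpose]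
  simp only [dotProduct, mulVec_diagonal]
  exact Finset.sum_congr rfl fun i _ => by ring

open Matrix in
/-- Deleting the last row and column of a real symmetric matrix lowers the number of positive
eigenvalues by at most one. -/
theorem Matrix.IsHermitian.card_pos_eigenvalues_le_submatrix_castSucc {m : ℕ}
    {A : Matrix (Fin (m + 1)) (Fin (m + 1)) ℝ} (hA : A.IsHermitian)
    (hB : (A.submatrix Fin.castSucc Fin.castSucc).IsHermitian) :
    (Finset.univ.filter fun i => 0 < hA.eigenvalues i).card ≤
      (Finset.univ.filter fun i => 0 < hB.eigenvalues i).card + 1 := by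
  by_contra! hlt
  let U : Matrix (Fin (m + 1)) (Fin (m + 1)) ℝ := hA.eigenvectorUnitary
  let V : Matrix (Fin m) (Fin m) ℝ := hB.eigenvectorUnitary
  let f : (Fin (m + 1) → ℝ) →ₗ[ℝ] ({i // ¬ 0 < hA.eigenvalues i} → ℝ) ×
      ({j // 0 < hB.eigenvalues j} → ℝ) × ℝ :=
    ((LinearMap.funLeft ℝ ℝ Subtype.val).comp U.transpose.mulVecLin).prod
      (((LinearMap.funLeft ℝ ℝ Subtype.val).comp
        (V.transpose.mulVecLin.comp (LinearMap.funLeft ℝ ℝ Fin.castSucc))).prod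
        (LinearMap.proj (Fin.last m)))
  have hker : LinearMap.ker f ≠ ⊥ := by
    apply LinearMap.ker_ne_bot_of_finrank_lt
    have hcompl := Fintype.card_subtype_compl fun i => 0 < hA.eigenvalues i
    have hle := Fintype.card_subtype_le fun i => 0 < hA.eigenvalues i
    simp only [Module.finrank_prod, Module.finrank_fintype_fun_eq_card, Module.finrank_self]
    rw [hcompl]
    rw [Fintype.card_fin] at *
    rw [← Fintype.card_subtype, ← Fintype.card_subtype] at hlt
    omega
  obtain ⟨x, hx, hx0⟩ := (Submodule.ne_bot_iff _).mp hker
  have hx' : f x = 0 := hx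
  have hU (i) (hi : ¬ 0 < hA.eigenvalues i) : (Uᵀ *ᵥ x) i = 0 :=
    congrFun (congrArg Prod.fst hx') ⟨i, hi⟩
  have hV (j) (hj : 0 < hB.eigenvalues j) : (Vᵀ *ᵥ (x ∘ Fin.castSucc)) j = 0 :=
    congrFun (congrArg (fun p => p.2.1) hx') ⟨j, hj⟩
  have hlast : x (Fin.last m) = 0 := congrArg (fun p => p.2.2) hx'
  have hrestrict : x ⬝ᵥ A *ᵥ x = (x ∘ Fin.castSucc) ⬝ᵥ
      A.submatrix Fin.castSucc Fin.castSucc *ᵥ (x ∘ Fin.castSucc) := by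
    simp [dotProduct, mulVec, Fin.sum_univ_castSucc, hlast]
  have hnonpos : x ⬝ᵥ A *ᵥ x ≤ 0 := by
    rw [hrestrict, hB.dotProduct_mulVec_eq_sum_eigenvalues]
    refine Finset.sum_nonpos fun j _ => ?_
    by_cases hj : 0 < hB.eigenvalues j
    · change _ * (Vᵀ *ᵥ _) j ^ 2 ≤ 0
      simp [hV j hj]
    · exact mul_nonpos_of_nonpos_of_nonneg (not_lt.mp hj) (sq_nonneg _)
  rw [hA.dotProduct_mulVec_eq_sum_eigenvalues] at hnonpos
  have hterm (i) : 0 ≤ hA.eigenvalues i * (Uᵀ *ᵥ x) i ^ 2 := by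
    by_cases hi : 0 < hA.eigenvalues i
    · positivity
    · simp [hU i hi]
  have hzero : Uᵀ *ᵥ x = 0 := by
    ext i
    by_cases hi : 0 < hA.eigenvalues i
    · have := (Finset.sum_eq_zero_iff_of_nonneg fun i _ => hterm i).mp
        (hnonpos.antisymm (Finset.sum_nonneg fun i _ => hterm i)) i (Finset.mem_univ i)
      simpa [hi.ne'] using this
    · exact hU i hi
  have hUU : U * Uᵀ = 1 := Unitary.coe_mul_star_self hA.eigenvectorUnitary
  exact hx0 (by rw [← one_mulVec x, ← hUU, ← mulVec_mulVec, hzero, mulVec_zero])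

theorem neg_one_pow_card_neg_mul_prod_pos {ι : Type*} [Fintype ι] (f : ι → ℝ)
    (hf : ∀ i, f i ≠ 0) :
    0 < (-1) ^ (Finset.univ.filter fun i => f i < 0).card * ∏ i, f i := by
  have h : (-1 : ℝ) ^ (Finset.univ.filter fun i => f i < 0).card =
      ∏ i, if f i < 0 then -1 else 1 := by
    simp [Finset.prod_ite]
  rw [h, ← Finset.prod_mul_distrib]
  refine Finset.prod_pos fun i _ => ?_
  split_ifs with hi
  · linarith
  · simpa using lt_of_le_of_ne (not_lt.mp hi) (hf i).symm

theorem card_pos_add_card_neg {ι : Type*} [Fintype ι] (f : ι → ℝ) (hf : ∀ i, f i ≠ 0) :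
    (Finset.univ.filter fun i => 0 < f i).card + (Finset.univ.filter fun i => f i < 0).card =
      Fintype.card ι := by
  have h : (Finset.univ.filter fun i => f i < 0) = Finset.univ.filter fun i => ¬ 0 < f i :=
    Finset.filter_congr fun i _ => by rw [not_lt, (hf i).le_iff_lt]
  rw [h, Finset.card_filter_add_card_filter_not, Finset.card_univ]

theorem Matrix.IsHermitian.eigenvalues_ne_zero_of_det_ne_zero {ι : Type*} [Fintype ι]
    [DecidableEq ι] {A : Matrix ι ι ℝ} (hA : A.IsHermitian) (hdet : A.det ≠ 0) (i : ι) :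
    hA.eigenvalues i ≠ 0 := by
  rw [hA.det_eq_prod_eigenvalues] at hdet
  simpa using Finset.prod_ne_zero_iff.mp hdet i (Finset.mem_univ i)

/-- The number of positive eigenvalues is odd when the determinant has sign `(-1) ^ m`. -/
theorem Matrix.IsHermitian.odd_card_pos_eigenvalues {m : ℕ}
    {A : Matrix (Fin (m + 1)) (Fin (m + 1)) ℝ} (hA : A.IsHermitian)
    (hsign : Real.sign A.det = (-1) ^ m) :
    Odd (Finset.univ.filter fun i => 0 < hA.eigenvalues i).card := by
  have hdet : A.det ≠ 0 := fun h =>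
    pow_ne_zero m (neg_ne_zero.mpr one_ne_zero) (by rw [← hsign, h, Real.sign_zero])
  have hne := hA.eigenvalues_ne_zero_of_det_ne_zero hdet
  have hcard := card_pos_add_card_neg _ hne
  have hprod := neg_one_pow_card_neg_mul_prod_pos _ hne
  have hpos := Real.sign_mul_pos_of_ne_zero _ hdet
  have hdet_eq : A.det = ∏ i, hA.eigenvalues i := by simpa using hA.det_eq_prod_eigenvalues
  rw [← hdet_eq] at hprod
  rw [hsign] at hpos
  rw [Fintype.card_fin] at hcard
  have heven : Even (m + (Finset.univ.filter fun i => hA.eigenvalues i < 0).card) := by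
    by_contra hodd
    have := mul_pos hpos hprod
    rw [mul_mul_mul_comm, ← pow_add, (Nat.not_even_iff_odd.mp hodd).neg_one_pow] at this
    nlinarith [mul_self_nonneg A.det]
  grind

theorem Matrix.IsHermitian.card_pos_eigenvalues_le_one {m : ℕ}
    {A : Matrix (Fin (m + 1)) (Fin (m + 1)) ℝ} (hA : A.IsHermitian)
    (hs : ∀ k : Fin (m + 1), 1 ≤ (k : ℕ) → Real.sign (leadMinor A k) = (-1) ^ (k : ℕ)) :
    (Finset.univ.filter fun i => 0 < hA.eigenvalues i).card ≤ 1 := by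
  induction m with
  | zero => exact (Finset.card_le_univ _).trans (by simp)
  | succ m ih =>
    have hB := hA.submatrix (Fin.castSucc : Fin (m + 1) → Fin (m + 2))
    have hle := hA.card_pos_eigenvalues_le_submatrix_castSucc hB
    have hprev := ih hB fun k hk => hs k.castSucc hk
    obtain ⟨r, hr⟩ := hA.odd_card_pos_eigenvalues (hs (Fin.last _) (by simp))
    omega

/-- if a real symmetric n×n matrix (n ≥ 2) has leading principal
minors D₁,…,D_n with D₁ = 0 and sign(D_k) = (-1)^{k-1} for k ≥ 2 (1-based;
0-based: sign(leadMinor A k) = (-1)^k for k ≥ 1), then A has inertia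
(1, n−1, 0). -/
theorem stmt15 (n : ℕ) (hn : 2 ≤ n) (A : Matrix (Fin n) (Fin n) ℝ)
    (hA : A.IsHermitian)
    (h1 : leadMinor A ⟨0, by omega⟩ = 0)
    (hs : ∀ k : Fin n, 1 ≤ (k : ℕ) →
      Real.sign (leadMinor A k) = (-1) ^ (k : ℕ)) :
    (Finset.univ.filter fun i => 0 < hA.eigenvalues i).card = 1 ∧
    (Finset.univ.filter fun i => hA.eigenvalues i < 0).card = n - 1 ∧
    (Finset.univ.filter fun i => hA.eigenvalues i = 0).card = 0 := by
  obtain ⟨m, rfl⟩ : ∃ m, n = m + 1 := ⟨n - 1, by omega⟩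
  have hsign : Real.sign A.det = (-1) ^ m := hs (Fin.last m) (by simp; omega)
  have hne := hA.eigenvalues_ne_zero_of_det_ne_zero fun h =>
    pow_ne_zero m (neg_ne_zero.mpr one_ne_zero) (by rw [← hsign, h, Real.sign_zero])
  obtain ⟨r, hr⟩ := hA.odd_card_pos_eigenvalues hsign
  have hle := hA.card_pos_eigenvalues_le_one hs
  have hcard := card_pos_add_card_neg _ hne
  rw [Fintype.card_fin] at hcard
  exact ⟨by omega, by omega, by simp [hne]⟩
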